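/- Let d_L, d_R ≥ 1, d = d_L·d_R, and let X_1,…,X_{T+1}, G_t, L_t be one-sided Shampoo iterates with parameters ε > 0 and η > 0, convex set 𝒳 ⊆ ℝ^{d_L×d_R}, and differentiable convex losses L_1,…,L_T : ℝ^{d_L×d_R} → ℝ. Then for every X* ∈ 𝒳: Σ_{t=1}^T L_t(X_t) − Σ_{t=1}^T L_t(X*) ≤ (D_op²/(2·d_R·η) + η)·(G + d·√ε), where D_op = max_{1≤t≤T} ‖X_t − X*‖_op and G = √(d_R)·Tr(√(Σ_{t=1}^T G_t G_tᵀ)). -/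

import Mathlib

open Matrix

attribute [local instance] Matrix.frobeniusNormedAddCommGroup Matrix.frobeniusNormedSpace

/-- The operator (spectral) norm of a real matrix: the supremum of the Euclidean norm
`‖Xv‖₂` over vectors `v` in the Euclidean unit ball. -/
noncomputable def opNorm {m n : ℕ} (X : Matrix (Fin m) (Fin n) ℝ) : ℝ :=
  sSup {r | ∃ v : Fin n → ℝ, v ⬝ᵥ v ≤ 1 ∧ r = Real.sqrt (X.mulVec v ⬝ᵥ X.mulVec v)}

/-- One-sided Shampoo iterates (Algorithm 2) with parameters `ε, η`, constraint set `𝒳`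
and differentiable convex losses `Lf 1, …, Lf T`.  Here `G t` is the gradient of `Lf t` at
`x t` (in the sense that the Fréchet derivative is `Δ ↦ Tr((G t)ᵀ Δ)`), `Lm t` is the
accumulated matrix `Lm (t-1) + (1/dR)·G t (G t)ᵀ`, and `S t` is the unique symmetric
positive semidefinite square root `√(Lm t)`. -/
def OneSidedShampoo {dL dR : ℕ} (ε η : ℝ) (𝒳 : Set (Matrix (Fin dL) (Fin dR) ℝ)) (T : ℕ)
    (Lf : ℕ → Matrix (Fin dL) (Fin dR) ℝ → ℝ)
    (x G : ℕ → Matrix (Fin dL) (Fin dR) ℝ)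
    (Lm S : ℕ → Matrix (Fin dL) (Fin dL) ℝ) : Prop :=
  x 1 ∈ 𝒳 ∧ Lm 0 = ε • (1 : Matrix (Fin dL) (Fin dL) ℝ) ∧
  ∀ t, 1 ≤ t → t ≤ T →
    Differentiable ℝ (Lf t) ∧ ConvexOn ℝ Set.univ (Lf t) ∧
    (∀ Δ : Matrix (Fin dL) (Fin dR) ℝ, fderiv ℝ (Lf t) (x t) Δ = ((G t)ᵀ * Δ).trace) ∧
    Lm t = Lm (t - 1) + (dR : ℝ)⁻¹ • (G t * (G t)ᵀ) ∧
    (S t).PosSemidef ∧ S t * S t = Lm t ∧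
    x (t + 1) ∈ 𝒳 ∧
    (∀ Y ∈ 𝒳,
      ((x (t + 1) - (x t - η • ((S t)⁻¹ * G t)))ᵀ * S t *
          (x (t + 1) - (x t - η • ((S t)⁻¹ * G t)))).trace ≤
      ((Y - (x t - η • ((S t)⁻¹ * G t)))ᵀ * S t *
          (Y - (x t - η • ((S t)⁻¹ * G t)))).trace)

open scoped MatrixOrder in
/-- The trace of a product of two positive semidefinite matrices is nonnegative. -/
lemma trace_mul_nonneg_of_posSemidef {n : Type*} [Fintype n]
    {M N : Matrix n n ℝ} (hM : M.PosSemidef) (hN : N.PosSemidef) : 0 ≤ (M * N).trace := by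
  classical
  obtain ⟨B, rfl⟩ := CStarAlgebra.nonneg_iff_eq_star_mul_self.mp hM.nonneg
  rw [Matrix.mul_assoc, Matrix.trace_mul_comm, star_eq_conjTranspose]
  exact (hN.mul_mul_conjTranspose_same B).trace_nonneg

/-- Operator monotonicity of the square root: if `A² ≤ B²` with `A` positive semidefinite and
`B` positive definite, then `A ≤ B`. -/
lemma posSemidef_sub_of_posSemidef_mul_self_sub {n : Type*} [Fintype n]
    {A B : Matrix n n ℝ} (hA : A.PosSemidef) (hB : B.PosDef)
    (h : (B * B - A * A).PosSemidef) : (B - A).PosSemidef := by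
  classical
  have hH : (B - A).IsHermitian := hB.1.sub hA.1
  rw [hH.posSemidef_iff_eigenvalues_nonneg]
  intro i
  set v : n → ℝ := ⇑(hH.eigenvectorBasis i)
  set l := hH.eigenvalues i
  have hev : (B - A) *ᵥ v = l • v := hH.mulVec_eigenvectorBasis i
  have hv0 : v ≠ 0 := fun h0 => hH.eigenvectorBasis.orthonormal.ne_zero i (by
    ext j; exact congrFun h0 j)
  have hBv : B *ᵥ v = A *ᵥ v + l • v := by rw [← hev, Matrix.sub_mulVec]; abel
  have hBpos := hB.dotProduct_mulVec_pos hv0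
  have hApos := hA.dotProduct_mulVec_nonneg v
  have hq := h.dotProduct_mulVec_nonneg v
  have key : star v ⬝ᵥ ((B * B - A * A) *ᵥ v)
      = l * (star v ⬝ᵥ (B *ᵥ v) + star v ⬝ᵥ (A *ᵥ v)) := by
    have hsq : B * B - A * A = B * (B - A) + (B - A) * A := by noncomm_ring
    have hsymm : star v ⬝ᵥ ((B - A) *ᵥ (A *ᵥ v)) = l * (star v ⬝ᵥ (A *ᵥ v)) := by
      have hT : (B - A)ᵀ = B - A := by simpa using hH.eq
      have hvec : v ᵥ* (B - A) = l • v := by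
        rw [← hev, ← Matrix.vecMul_transpose, hT]
      simp only [star_trivial]
      rw [Matrix.dotProduct_mulVec, hvec, smul_dotProduct, smul_eq_mul]
    rw [hsq, Matrix.add_mulVec, dotProduct_add, ← Matrix.mulVec_mulVec, ← Matrix.mulVec_mulVec,
      hev, hsymm, Matrix.mulVec_smul, dotProduct_smul, smul_eq_mul]
    ring
  rw [key] at hq
  exact nonneg_of_mul_nonneg_left hq (by linarith)

/-- The defining bound of the operator norm: `‖X v‖² ≤ ‖X‖_op² ‖v‖²`. -/
lemma mulVec_dotProduct_self_le_opNorm_sq {m n : ℕ} (X : Matrix (Fin m) (Fin n) ℝ)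
    (v : Fin n → ℝ) : X *ᵥ v ⬝ᵥ X *ᵥ v ≤ opNorm X ^ 2 * (v ⬝ᵥ v) := by
  have hbdd : BddAbove {r | ∃ v : Fin n → ℝ, v ⬝ᵥ v ≤ 1 ∧
      r = Real.sqrt (X.mulVec v ⬝ᵥ X.mulVec v)} := by
    refine ⟨Real.sqrt (∑ i, ∑ j, X i j ^ 2), ?_⟩
    rintro r ⟨w, hw, rfl⟩
    refine Real.sqrt_le_sqrt (Finset.sum_le_sum fun i _ => ?_)
    have hcs := Finset.sum_mul_sq_le_sq_mul_sq Finset.univ (X i) w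
    have hw' : ∑ j, w j ^ 2 ≤ 1 := by simpa [dotProduct, sq] using hw
    have hX : 0 ≤ ∑ j, X i j ^ 2 := by positivity
    calc (X *ᵥ w) i * (X *ᵥ w) i = (∑ j, X i j * w j) ^ 2 := by
          rw [sq]; rfl
      _ ≤ _ := hcs.trans (mul_le_of_le_one_right hX hw')
  rcases (dotProduct_self_star_nonneg v).eq_or_lt with h0 | hpos
  · have hv : v = 0 := by
      rw [star_trivial] at h0
      exact dotProduct_self_eq_zero.mp h0.symm
    simp [hv]
  · rw [star_trivial] at hpos
    set a := Real.sqrt (v ⬝ᵥ v)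
    have ha2 : a ^ 2 = v ⬝ᵥ v := Real.sq_sqrt hpos.le
    have hapos : 0 < a := Real.sqrt_pos.mpr hpos
    have hle : Real.sqrt (X *ᵥ (a⁻¹ • v) ⬝ᵥ X *ᵥ (a⁻¹ • v)) ≤ opNorm X := by
      refine le_csSup hbdd ⟨a⁻¹ • v, ?_, rfl⟩
      rw [smul_dotProduct, dotProduct_smul, ← ha2]
      simp only [smul_eq_mul]
      field_simp
      exact le_rfl
    have hsq := (Real.sqrt_le_left ((Real.sqrt_nonneg _).trans hle)).mp hle
    rw [Matrix.mulVec_smul, smul_dotProduct, dotProduct_smul, smul_eq_mul, smul_eq_mul] at hsq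
    rw [← ha2]
    calc X *ᵥ v ⬝ᵥ X *ᵥ v = (a⁻¹ * (a⁻¹ * (X *ᵥ v ⬝ᵥ X *ᵥ v))) * a ^ 2 := by
          field_simp
      _ ≤ _ := by gcongr

lemma opNorm_nonneg {m n : ℕ} (X : Matrix (Fin m) (Fin n) ℝ) : 0 ≤ opNorm X :=
  Real.sSup_nonneg (by rintro r ⟨v, -, rfl⟩; exact Real.sqrt_nonneg _)

/-- If `‖X‖_op ≤ c`, then `X Xᵀ ≤ c² I`. -/
lemma posSemidef_sq_smul_one_sub_mul_transpose {m n : ℕ} (X : Matrix (Fin m) (Fin n) ℝ) {c : ℝ}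
    (hc : opNorm X ≤ c) : (c ^ 2 • (1 : Matrix (Fin m) (Fin m) ℝ) - X * Xᵀ).PosSemidef := by
  refine .of_dotProduct_mulVec_nonneg ?_ fun u => ?_
  · rw [Matrix.IsHermitian, conjTranspose_eq_transpose_of_trivial]
    simp [Matrix.transpose_mul]
  · set w := Xᵀ *ᵥ u with hw
    have h1 : u ⬝ᵥ ((X * Xᵀ) *ᵥ u) = w ⬝ᵥ w := by
      rw [← Matrix.mulVec_mulVec, Matrix.dotProduct_mulVec, hw, Matrix.mulVec_transpose]
    have h2 : u ⬝ᵥ (X *ᵥ w) = w ⬝ᵥ w := by rw [← h1, hw, Matrix.mulVec_mulVec]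
    have hcs : (u ⬝ᵥ (X *ᵥ w)) ^ 2 ≤ (u ⬝ᵥ u) * (X *ᵥ w ⬝ᵥ X *ᵥ w) := by
      simpa [dotProduct, sq] using Finset.sum_mul_sq_le_sq_mul_sq Finset.univ u (X *ᵥ w)
    have hX := mulVec_dotProduct_self_le_opNorm_sq X w
    have hww : 0 ≤ w ⬝ᵥ w := by simpa using dotProduct_self_star_nonneg w
    have huu : 0 ≤ u ⬝ᵥ u := by simpa using dotProduct_self_star_nonneg u
    have hcc : opNorm X ^ 2 ≤ c ^ 2 := pow_le_pow_left₀ (opNorm_nonneg X) hc 2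
    have hmain : (w ⬝ᵥ w) * (w ⬝ᵥ w) ≤ (c ^ 2 * (u ⬝ᵥ u)) * (w ⬝ᵥ w) := by
      calc (w ⬝ᵥ w) * (w ⬝ᵥ w) = (u ⬝ᵥ (X *ᵥ w)) ^ 2 := by rw [h2]; ring
        _ ≤ (u ⬝ᵥ u) * (c ^ 2 * (w ⬝ᵥ w)) := by
          refine hcs.trans (mul_le_mul_of_nonneg_left (hX.trans ?_) huu)
          exact mul_le_mul_of_nonneg_right hcc hww
        _ = _ := by ring
    have hfin : w ⬝ᵥ w ≤ c ^ 2 * (u ⬝ᵥ u) := by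
      rcases hww.eq_or_lt with h0 | hpos
      · rw [← h0]; positivity
      · exact le_of_mul_le_mul_right hmain hpos
    rw [star_trivial, Matrix.sub_mulVec, dotProduct_sub, h1, Matrix.smul_mulVec,
      Matrix.one_mulVec, dotProduct_smul, smul_eq_mul]
    linarith

lemma trace_transpose_mul_mul_le {m n : ℕ} {M : Matrix (Fin m) (Fin m) ℝ} (hM : M.PosSemidef)
    {X : Matrix (Fin m) (Fin n) ℝ} {c : ℝ} (hc : opNorm X ≤ c) :
    (Xᵀ * M * X).trace ≤ c ^ 2 * M.trace := by
  have h := trace_mul_nonneg_of_posSemidef hM (posSemidef_sq_smul_one_sub_mul_transpose X hc)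
  rw [Matrix.mul_sub, Matrix.trace_sub, Matrix.mul_smul, Matrix.mul_one, Matrix.trace_smul,
    smul_eq_mul, ← Matrix.mul_assoc, Matrix.trace_mul_comm, ← Matrix.mul_assoc] at h
  linarith

/-- The first-order convexity inequality. -/
lemma ConvexOn.sub_le_fderiv_sub {E : Type*} [NormedAddCommGroup E] [NormedSpace ℝ E] {f : E → ℝ}
    (hf : ConvexOn ℝ Set.univ f) {x : E} (hd : DifferentiableAt ℝ f x) (y : E) :
    f x - f y ≤ fderiv ℝ f x (x - y) := by
  have hline : ConvexOn ℝ Set.univ (f ∘ AffineMap.lineMap (k := ℝ) x y) := by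
    simpa using hf.comp_affineMap (AffineMap.lineMap (k := ℝ) x y)
  have hderiv : HasDerivAt (f ∘ AffineMap.lineMap (k := ℝ) x y) (fderiv ℝ f x (y - x)) 0 := by
    have h1 : HasDerivAt (AffineMap.lineMap (k := ℝ) x y) (y - x) 0 := AffineMap.hasDerivAt_lineMap
    refine HasFDerivAt.comp_hasDerivAt (0 : ℝ) ?_ h1
    simpa using hd.hasFDerivAt
  have h := hline.le_slope_of_hasDerivAt (Set.mem_univ 0) (Set.mem_univ 1) one_pos hderiv
  rw [← neg_sub y x, map_neg]
  simp only [slope_def_field, Function.comp_apply, AffineMap.lineMap_apply_one,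
    AffineMap.lineMap_apply_zero, sub_zero, div_one] at h
  linarith

lemma trace_transpose_mul_mul_nonneg {m n : Type*} [Fintype m] [Fintype n]
    {S : Matrix m m ℝ} (hS : S.PosSemidef) (A : Matrix m n ℝ) : 0 ≤ (Aᵀ * S * A).trace := by
  simpa using (hS.conjTranspose_mul_mul_same A).trace_nonneg

lemma trace_transpose_mul_mul_add_smul {m n : Type*} [Fintype m] [Fintype n]
    {S : Matrix m m ℝ} (hS : S.PosSemidef) (A B : Matrix m n ℝ) (s : ℝ) :
    ((A + s • B)ᵀ * S * (A + s • B)).trace =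
      (Aᵀ * S * A).trace + 2 * s * (Aᵀ * S * B).trace + s ^ 2 * (Bᵀ * S * B).trace := by
  have hsymm : (Bᵀ * S * A).trace = (Aᵀ * S * B).trace := by
    have hT : Sᵀ = S := by simpa using hS.1.eq
    rw [← Matrix.trace_transpose]
    simp [Matrix.transpose_mul, hT, Matrix.mul_assoc]
  simp only [Matrix.transpose_add, Matrix.transpose_smul, Matrix.add_mul, Matrix.mul_add,
    Matrix.smul_mul, Matrix.mul_smul, Matrix.trace_add, Matrix.trace_smul, smul_eq_mul, hsymm]
  ring

/-- Projecting onto a convex set in the seminorm `A ↦ Tr(Aᵀ S A)` does not increase the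
distance to points of the set. -/
lemma trace_sub_projection_le {m n : Type*} [Fintype m] [Fintype n]
    {S : Matrix m m ℝ} (hS : S.PosSemidef) {K : Set (Matrix m n ℝ)} (hK : Convex ℝ K)
    {p z y : Matrix m n ℝ} (hp : p ∈ K) (hy : y ∈ K)
    (hmin : ∀ w ∈ K, ((p - z)ᵀ * S * (p - z)).trace ≤ ((w - z)ᵀ * S * (w - z)).trace) :
    ((p - y)ᵀ * S * (p - y)).trace ≤ ((z - y)ᵀ * S * (z - y)).trace := by
  set b := ((p - z)ᵀ * S * (y - p)).trace with hb
  set q := ((y - p)ᵀ * S * (y - p)).trace with hq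
  have hq0 : 0 ≤ q := trace_transpose_mul_mul_nonneg hS _
  have hb0 : 0 ≤ b := by
    by_contra! hneg
    have hden : 0 < q - b := by linarith
    set s := -b / (q - b)
    have hs0 : 0 < s := div_pos (by linarith) hden
    have hs1 : s ≤ 1 := (div_le_one hden).mpr (by linarith)
    have h := hmin _ (hK.add_smul_sub_mem hp hy ⟨hs0.le, hs1⟩)
    rw [show p + s • (y - p) - z = (p - z) + s • (y - p) by abel,
      trace_transpose_mul_mul_add_smul hS, ← hb, ← hq] at h
    have hsq : s * (q - b) = -b := div_mul_cancel₀ _ hden.ne'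
    nlinarith [mul_pos hs0 hs0]
  have hexp := trace_transpose_mul_mul_add_smul hS (p - z) (y - p) 1
  have hz := trace_transpose_mul_mul_nonneg hS (p - z)
  rw [← hb, ← hq, one_smul, sub_add_sub_comm, add_comm p y, add_sub_add_right_eq_sub] at hexp
  have hneg : ∀ A : Matrix m n ℝ, ((-A)ᵀ * S * (-A)).trace = (Aᵀ * S * A).trace := fun A => by
    rw [Matrix.transpose_neg, Matrix.neg_mul, Matrix.neg_mul, Matrix.mul_neg, neg_neg]
  rw [← neg_sub y p, ← neg_sub y z, hneg, hneg, hexp]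
  linarith

/-- `Tr(S⁻¹ (S² - P²)) ≤ 2 Tr(S - P)`. -/
lemma trace_inv_mul_sub_le {n : Type*} [Fintype n] [DecidableEq n] {S P : Matrix n n ℝ}
    (hS : S.PosDef) (hP : P.IsHermitian) :
    (S⁻¹ * (S * S - P * P)).trace ≤ 2 * (S.trace - P.trace) := by
  have hdet : IsUnit S.det := (Matrix.isUnit_iff_isUnit_det S).mp hS.isUnit
  have h := (hS.posSemidef.inv.conjTranspose_mul_mul_same (S - P)).trace_nonneg
  rw [(hS.1.sub hP).eq] at h
  have hexp : (S - P) * S⁻¹ * (S - P) = S - P - P + P * S⁻¹ * P := by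
    rw [Matrix.sub_mul, Matrix.mul_nonsing_inv S hdet, Matrix.sub_mul, Matrix.one_mul,
      Matrix.mul_sub, Matrix.nonsing_inv_mul_cancel_right _ _ hdet]
    abel
  have hcyc : (P * S⁻¹ * P).trace = (S⁻¹ * (P * P)).trace := by
    rw [Matrix.mul_assoc, Matrix.trace_mul_comm, Matrix.mul_assoc]
  rw [hexp, Matrix.trace_add, Matrix.trace_sub, Matrix.trace_sub, hcyc] at h
  rw [Matrix.mul_sub, Matrix.trace_sub, Matrix.nonsing_inv_mul_cancel_left _ _ hdet]
  linarith

/-- Expansion of the squared `S`-distance after a preconditioned gradient step. -/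
lemma trace_gradient_step {m n : Type*} [Fintype m] [Fintype n] [DecidableEq m]
    {S : Matrix m m ℝ} (hS : S.PosDef) (X G Y : Matrix m n ℝ) (η : ℝ) :
    ((X - η • (S⁻¹ * G) - Y)ᵀ * S * (X - η • (S⁻¹ * G) - Y)).trace =
      ((X - Y)ᵀ * S * (X - Y)).trace - 2 * η * (Gᵀ * (X - Y)).trace
        + η ^ 2 * (S⁻¹ * (G * Gᵀ)).trace := by
  have hdet : IsUnit S.det := (Matrix.isUnit_iff_isUnit_det S).mp hS.isUnit
  have hT : (S⁻¹)ᵀ = S⁻¹ := by simpa using hS.inv.1.eq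
  have h := trace_transpose_mul_mul_add_smul hS.posSemidef (X - Y) (S⁻¹ * G) (-η)
  have h1 : ((X - Y)ᵀ * S * (S⁻¹ * G)).trace = (Gᵀ * (X - Y)).trace := by
    rw [Matrix.mul_assoc, Matrix.mul_nonsing_inv_cancel_left _ _ hdet, ← Matrix.trace_transpose]
    simp [Matrix.transpose_mul]
  have h2 : ((S⁻¹ * G)ᵀ * S * (S⁻¹ * G)).trace = (S⁻¹ * (G * Gᵀ)).trace := by
    rw [Matrix.mul_assoc, Matrix.mul_nonsing_inv_cancel_left _ _ hdet, Matrix.transpose_mul, hT,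
      Matrix.mul_assoc, Matrix.trace_mul_comm, Matrix.mul_assoc]
  rw [h1, h2] at h
  rw [show X - η • (S⁻¹ * G) - Y = (X - Y) + (-η) • (S⁻¹ * G) by rw [neg_smul]; abel, h]
  ring

/-- A positive semidefinite square root of a positive definite matrix is positive definite. -/
lemma posDef_of_mul_self_posDef {n : Type*} [Fintype n] [DecidableEq n] {S : Matrix n n ℝ}
    (hS : S.PosSemidef) (h : (S * S).PosDef) : S.PosDef :=
  hS.posDef_iff_isUnit.mpr (isUnit_of_mul_isUnit_left h.isUnit)

theorem stmt_12 {dL dR : ℕ} (hdL : 1 ≤ dL) (hdR : 1 ≤ dR) (d : ℕ) (hd : d = dL * dR)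
    (ε η : ℝ) (hε : 0 < ε) (hη : 0 < η)
    (𝒳 : Set (Matrix (Fin dL) (Fin dR) ℝ)) (h𝒳conv : Convex ℝ 𝒳) (h𝒳ne : 𝒳.Nonempty)
    (T : ℕ) (hT : 1 ≤ T) (Lf : ℕ → Matrix (Fin dL) (Fin dR) ℝ → ℝ)
    (x G : ℕ → Matrix (Fin dL) (Fin dR) ℝ) (Lm S : ℕ → Matrix (Fin dL) (Fin dL) ℝ)
    (hiter : OneSidedShampoo ε η 𝒳 T Lf x G Lm S) :
    ∀ Xstar ∈ 𝒳, ∀ Dop Gval : ℝ, ∀ SG : Matrix (Fin dL) (Fin dL) ℝ,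
      Dop = sSup {r | ∃ t, 1 ≤ t ∧ t ≤ T ∧ r = opNorm (x t - Xstar)} →
      SG.PosSemidef → SG * SG = ∑ t ∈ Finset.Icc 1 T, G t * (G t)ᵀ →
      Gval = Real.sqrt dR * SG.trace →
      ∑ t ∈ Finset.Icc 1 T, Lf t (x t) - ∑ t ∈ Finset.Icc 1 T, Lf t Xstar ≤
        (Dop ^ 2 / (2 * dR * η) + η) * (Gval + d * Real.sqrt ε) := by
  obtain ⟨-, hL0, hstep⟩ := hiter
  intro Xstar hXstar Dop Gval SG hDop hSG hSGsq hGval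
  have hdR0 : (0 : ℝ) < dR := by exact_mod_cast hdR
  have hLsum : ∀ n ≤ T, Lm n = ε • (1 : Matrix (Fin dL) (Fin dL) ℝ)
      + (dR : ℝ)⁻¹ • ∑ t ∈ Finset.Icc 1 n, G t * (G t)ᵀ := by
    intro n
    induction n with
    | zero => intro _; simp [hL0]
    | succ n ih =>
      intro hn
      obtain ⟨-, -, -, hL, -⟩ := hstep (n + 1) (by omega) hn
      rw [hL, Nat.add_sub_cancel, ih (by omega), Finset.sum_Icc_succ_top (by omega), smul_add,
        add_assoc]
  have hGG : ∀ t, (G t * (G t)ᵀ).PosSemidef := fun t => by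
    simpa using Matrix.posSemidef_self_mul_conjTranspose (G t)
  have hLpos : ∀ n ≤ T, (Lm n).PosDef := by
    intro n hn
    rw [hLsum n hn]
    refine (Matrix.PosDef.one.smul hε).add_posSemidef (.smul ?_ (inv_nonneg.mpr hdR0.le))
    exact Matrix.posSemidef_sum _ fun t _ => hGG t
  -- The square roots of the accumulated matrices, including the initial one.
  set P : ℕ → Matrix (Fin dL) (Fin dL) ℝ := fun n => if n = 0 then Real.sqrt ε • 1 else S n with hP
  have hP0 : P 0 = Real.sqrt ε • 1 := by simp [hP]
  have hPsucc : ∀ n, P (n + 1) = S (n + 1) := fun n => by simp [hP]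
  have hPsq : ∀ n ≤ T, P n * P n = Lm n := by
    rintro (_ | n) hn
    · rw [hP0, hL0, smul_mul_smul_comm, Real.mul_self_sqrt hε.le, one_mul]
    · rw [hPsucc]
      exact (hstep (n + 1) (by omega) hn).2.2.2.2.2.1
  have hPdef : ∀ n ≤ T, (P n).PosDef := by
    intro n hn
    refine posDef_of_mul_self_posDef ?_ (hPsq n hn ▸ hLpos n hn)
    rcases n with _ | n
    · rw [hP0]; exact Matrix.PosSemidef.one.smul (Real.sqrt_nonneg ε)
    · rw [hPsucc]; exact (hstep (n + 1) (by omega) hn).2.2.2.2.1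
  have hD : ∀ t, 1 ≤ t → t ≤ T → opNorm (x t - Xstar) ≤ Dop := by
    intro t h1 h2
    rw [hDop]
    refine le_csSup (Set.Finite.bddAbove ?_) ⟨t, h1, h2, rfl⟩
    refine ((Set.finite_Icc 1 T).image fun t => opNorm (x t - Xstar)).subset ?_
    rintro r ⟨t, h1, h2, rfl⟩
    exact ⟨t, ⟨h1, h2⟩, rfl⟩
  have hregret : ∀ n ≤ T, 2 * η * ∑ t ∈ Finset.Icc 1 n, ((G t)ᵀ * (x t - Xstar)).trace ≤
      Dop ^ 2 * (P n).trace - ((x (n + 1) - Xstar)ᵀ * P n * (x (n + 1) - Xstar)).trace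
        + 2 * η ^ 2 * dR * ((P n).trace - (P 0).trace) := by
    intro n
    induction n with
    | zero =>
      intro _
      have h := trace_transpose_mul_mul_le (hPdef 0 (by omega)).posSemidef (hD 1 le_rfl hT)
      simpa using h
    | succ n ih =>
      intro hn
      obtain ⟨-, -, -, hL, -, -, hxmem, hmin⟩ := hstep (n + 1) (by omega) hn
      rw [← hPsucc] at hmin
      have hPn := hPdef (n + 1) hn
      have hproj := trace_sub_projection_le hPn.posSemidef h𝒳conv hxmem hXstar hmin
      rw [trace_gradient_step hPn] at hproj
      rw [Nat.add_sub_cancel, ← hPsq n (by omega), ← hPsq (n + 1) hn] at hL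
      have hGeq : (dR : ℝ)⁻¹ • (G (n + 1) * (G (n + 1))ᵀ)
          = P (n + 1) * P (n + 1) - P n * P n := by rw [hL]; abel
      have hmono : (P (n + 1) - P n).PosSemidef := by
        refine posSemidef_sub_of_posSemidef_mul_self_sub (hPdef n (by omega)).posSemidef hPn ?_
        rw [← hGeq]
        exact (hGG _).smul (inv_nonneg.mpr hdR0.le)
      have hdrift := trace_transpose_mul_mul_le hmono (hD (n + 1) (by omega) hn)
      rw [Matrix.mul_sub _ (P (n + 1)), Matrix.sub_mul, Matrix.trace_sub, Matrix.trace_sub] at hdrift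
      have hgrad := trace_inv_mul_sub_le hPn (hPdef n (by omega)).1
      rw [← hGeq, Matrix.mul_smul, Matrix.trace_smul, smul_eq_mul, inv_mul_le_iff₀ hdR0] at hgrad
      have hgrad' := mul_le_mul_of_nonneg_left hgrad (sq_nonneg η)
      rw [Finset.sum_Icc_succ_top (by omega)]
      have := ih (by omega)
      linarith
  have hPT := hPdef T le_rfl
  have htrace : (dR : ℝ) * (P T).trace ≤ Gval + d * Real.sqrt ε := by
    set r := Real.sqrt dR
    have hr0 : 0 < r := Real.sqrt_pos.mpr hdR0
    have hrr : r * r = dR := Real.mul_self_sqrt hdR0.le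
    have hsε : 0 < Real.sqrt ε := Real.sqrt_pos.mpr hε
    have hBdef : (Real.sqrt ε • (1 : Matrix (Fin dL) (Fin dL) ℝ) + r⁻¹ • SG).PosDef :=
      (Matrix.PosDef.one.smul hsε).add_posSemidef (hSG.smul (inv_nonneg.mpr hr0.le))
    have hle := posSemidef_sub_of_posSemidef_mul_self_sub hPT.posSemidef hBdef (by
      have hsq : (Real.sqrt ε • (1 : Matrix (Fin dL) (Fin dL) ℝ) + r⁻¹ • SG)
          * (Real.sqrt ε • 1 + r⁻¹ • SG) - P T * P T = (2 * Real.sqrt ε * r⁻¹) • SG := by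
        rw [hPsq T le_rfl, hLsum T le_rfl, ← hSGsq, ← hrr]
        nth_rewrite 3 [← Real.mul_self_sqrt hε.le]
        simp only [Matrix.add_mul, Matrix.mul_add, Matrix.smul_mul, Matrix.mul_smul,
          Matrix.one_mul, Matrix.mul_one, mul_inv]
        module
      rw [hsq]
      exact hSG.smul (by positivity))
    have h := hle.trace_nonneg
    rw [Matrix.trace_sub, Matrix.trace_add, Matrix.trace_smul, Matrix.trace_smul,
      Matrix.trace_one, Fintype.card_fin, smul_eq_mul, smul_eq_mul] at h
    have hmul := mul_le_mul_of_nonneg_left (sub_nonneg.mp h) hdR0.le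
    have hcancel : (dR : ℝ) * (r⁻¹ * SG.trace) = r * SG.trace := by
      rw [← hrr]; field_simp
    rw [mul_add, hcancel] at hmul
    rw [hGval, hd]
    push_cast
    linarith
  have hloss : ∑ t ∈ Finset.Icc 1 T, Lf t (x t) - ∑ t ∈ Finset.Icc 1 T, Lf t Xstar ≤
      ∑ t ∈ Finset.Icc 1 T, ((G t)ᵀ * (x t - Xstar)).trace := by
    rw [← Finset.sum_sub_distrib]
    refine Finset.sum_le_sum fun t ht => ?_
    obtain ⟨h1, h2⟩ := Finset.mem_Icc.mp ht
    obtain ⟨hdiff, hconv, hgrad, -⟩ := hstep t h1 h2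
    rw [← hgrad]
    exact hconv.sub_le_fderiv_sub (hdiff _) Xstar
  have hfinal : 2 * η * ∑ t ∈ Finset.Icc 1 T, ((G t)ᵀ * (x t - Xstar)).trace ≤
      (Dop ^ 2 + 2 * η ^ 2 * dR) * (P T).trace := by
    have h1 := trace_transpose_mul_mul_nonneg hPT.posSemidef (x (T + 1) - Xstar)
    have h2 : 0 ≤ 2 * η ^ 2 * dR * (P 0).trace :=
      mul_nonneg (by positivity) (hPdef 0 (by omega)).posSemidef.trace_nonneg
    linarith [hregret T le_rfl]
  calc _ ≤ ∑ t ∈ Finset.Icc 1 T, ((G t)ᵀ * (x t - Xstar)).trace := hloss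
    _ ≤ (Dop ^ 2 + 2 * η ^ 2 * dR) * (P T).trace / (2 * η) := by
      rw [le_div_iff₀ (by positivity)]
      linarith
    _ = (Dop ^ 2 / (2 * dR * η) + η) * (dR * (P T).trace) := by field_simp
    _ ≤ _ := mul_le_mul_of_nonneg_left htrace (by positivity)
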